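/- Under the hypotheses of the singularity criterion, the function f(x) = Σ_{i=1}^∞ x_i·r(x)_i·α^i is differentiable with derivative zero at Lebesgue-almost every point of [0,1]. -/

import Mathlib

/-- The `i`-th binary digit of `x` (indices from 1), using the terminating
(floor) expansion at dyadic rationals. -/
noncomputable def binDigit (x : ℝ) (i : ℕ) : ℕ := ⌊x * 2 ^ i⌋.toNat % 2

/-- `runCount b i s`: the number of maximal runs of exactly `s` consecutive 1s
among the digits `b 1, …, b (i-1)`. -/
def runCount (b : ℕ → ℕ) (i s : ℕ) : ℕ :=
  ((Finset.Icc 1 i).filter fun m =>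
    m + s ≤ i ∧ (∀ t ∈ Finset.Ico m (m + s), b t = 1) ∧
      (m = 1 ∨ b (m - 1) = 0) ∧ (m + s = i ∨ b (m + s) = 0)).card

/-- `r(x)_i = Π_s q(s)^{p_{i,s}}` where `p_{i,s}` counts maximal runs of `s`
consecutive 1s among the first `i-1` binary digits (`q 0 = 1`, so the factor
`s = 0` is omitted). -/
noncomputable def rWeight (q : ℕ → ℕ) (b : ℕ → ℕ) (i : ℕ) : ℝ :=
  ∏ s ∈ Finset.Icc 1 i, (q s : ℝ) ^ runCount b i s

/-- `f(x) = Σ_{i≥1} x_i · r(x)_i · α^i` (with `f 1 = 1`, corresponding to the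
all-ones expansion of `1`). -/
noncomputable def fCA (α : ℝ) (q : ℕ → ℕ) (x : ℝ) : ℝ :=
  if x = 1 then 1 else
    ∑' i : ℕ, (binDigit x (i + 1) : ℝ) * rWeight q (binDigit x) (i + 1) * α ^ (i + 1)

open MeasureTheory


lemma rc_zero (b : ℕ → ℕ) (j s : ℕ) (hs : j < s) : runCount b j s = 0 := by
  unfold runCount
  rw [Finset.card_eq_zero, Finset.filter_eq_empty_iff]
  intro m hm h
  simp only [Finset.mem_Icc] at hm
  omega

lemma rc_split (b : ℕ → ℕ) (j m s : ℕ) (hs : 0 < s) (hj : j = 0 ∨ b j = 0)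
    (h1 : ∀ t, j < t → t < j + 1 + m → b t = 1) :
    runCount b (j + 1 + m) s = runCount b j s + if s = m then 1 else 0 := by
  unfold runCount
  have key : ((Finset.Icc 1 (j + 1 + m)).filter fun k =>
      k + s ≤ (j + 1 + m) ∧ (∀ t ∈ Finset.Ico k (k + s), b t = 1) ∧
      (k = 1 ∨ b (k - 1) = 0) ∧ (k + s = (j + 1 + m) ∨ b (k + s) = 0)) =
      ((Finset.Icc 1 j).filter fun k =>
      k + s ≤ j ∧ (∀ t ∈ Finset.Ico k (k + s), b t = 1) ∧
      (k = 1 ∨ b (k - 1) = 0) ∧ (k + s = j ∨ b (k + s) = 0)) ∪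
      (if s = m then {j + 1} else ∅) := by
    ext k
    simp only [Finset.mem_filter, Finset.mem_union, Finset.mem_Icc, Finset.mem_Ico]
    constructor
    · rintro ⟨⟨hk1, hk2⟩, hk3, hk4, hk5, hk6⟩
      by_cases hkj : k ≤ j
      · left
        have hbj : b j = 0 := by rcases hj with h | h <;> [omega; exact h]
        have : k + s ≤ j := by
          by_contra hc
          have := hk4 j ⟨hkj, by omega⟩
          omega
        refine ⟨⟨hk1, hkj⟩, this, hk4, hk5, ?_⟩
        rcases hk6 with h | h
        · omega
        · exact Or.inr h
      · right
        have hk : k = j + 1 := by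
          by_contra hc
          rcases hk5 with h | h
          · omega
          · have := h1 (k - 1) (by omega) (by omega)
            omega
        have : s = m := by
          rcases hk6 with h | h
          · omega
          · by_contra hc
            have := h1 (k + s) (by omega) (by omega)
            omega
        rw [if_pos this, hk]
        simp
    · rintro (⟨⟨hk1, hk2⟩, hk3, hk4, hk5, hk6⟩ | h)
      · refine ⟨⟨hk1, by omega⟩, by omega, hk4, hk5, ?_⟩
        right
        rcases hk6 with h | h
        · rw [h]
          rcases hj with h | h <;> [omega; exact h]
        · exact h
      · split_ifs at h with hsm
        · simp only [Finset.mem_singleton] at h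
          subst h
          refine ⟨by omega, by omega, fun t ht => h1 t (by omega) (by omega), ?_, Or.inl (by omega)⟩
          rcases hj with h | h
          · left; omega
          · right; simpa using h
        · simp at h
  rw [key, Finset.card_union_of_disjoint]
  · congr 1
    split_ifs <;> simp
  · rw [Finset.disjoint_left]
    intro k hk hk'
    simp only [Finset.mem_filter, Finset.mem_Icc] at hk
    split_ifs at hk' with hsm
    · simp at hk'; omega
    · simp at hk'

lemma rW_split (q : ℕ → ℕ) (hq0 : q 0 = 1) (b : ℕ → ℕ) (j m : ℕ) (hj : j = 0 ∨ b j = 0)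
    (h1 : ∀ t, j < t → t < j + 1 + m → b t = 1) :
    rWeight q b (j + 1 + m) = rWeight q b j * q m := by
  unfold rWeight
  have e1 : ∏ s ∈ Finset.Icc 1 j, (q s : ℝ) ^ runCount b j s =
      ∏ s ∈ Finset.Icc 1 (j + 1 + m), (q s : ℝ) ^ runCount b j s := by
    apply Finset.prod_subset
    · intro s hs
      simp only [Finset.mem_Icc] at *
      omega
    · intro s hs hs'
      simp only [Finset.mem_Icc] at *
      rw [rc_zero b j s (by omega), pow_zero]
  have e2 : (q m : ℝ) = ∏ s ∈ Finset.Icc 1 (j + 1 + m), (q s : ℝ) ^ (if s = m then 1 else 0) := by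
    rcases Nat.eq_zero_or_pos m with h | h
    · subst h
      rw [Finset.prod_eq_one]
      · simp [hq0]
      · intro s hs
        simp only [Finset.mem_Icc] at hs
        rw [if_neg (by omega), pow_zero]
    · rw [Finset.prod_eq_single m]
      · simp
      · intro s hs hsm
        simp [hsm]
      · intro hm
        simp only [Finset.mem_Icc] at hm
        omega
  rw [e1, e2, ← Finset.prod_mul_distrib]
  apply Finset.prod_congr rfl
  intro s hs
  simp only [Finset.mem_Icc] at hs
  rw [rc_split b j m s (by omega) hj h1, pow_add]

lemma rW_congr (q : ℕ → ℕ) (b c : ℕ → ℕ) (i : ℕ) (h : ∀ t, 1 ≤ t → t < i → b t = c t) :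
    rWeight q b i = rWeight q c i := by
  unfold rWeight
  apply Finset.prod_congr rfl
  intro s hs
  simp only [Finset.mem_Icc] at hs
  congr 1
  unfold runCount
  congr 1
  apply Finset.filter_congr
  intro m hm
  simp only [Finset.mem_Icc, Finset.mem_Ico] at *
  apply and_congr_right
  intro hms
  apply and_congr
  · constructor
    · intro hh t ht
      rw [← h t (by omega) (by omega)]; exact hh t ht
    · intro hh t ht
      rw [h t (by omega) (by omega)]; exact hh t ht
  apply and_congr
  · by_cases hm1 : m = 1
    · simp [hm1]
    · rw [h (m - 1) (by omega) (by omega)]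
  · by_cases hm1 : m + s = i
    · simp [hm1]
    · rw [h (m + s) (by omega) (by omega)]

lemma rW_nonneg (q : ℕ → ℕ) (b : ℕ → ℕ) (i : ℕ) : 0 ≤ rWeight q b i := by
  unfold rWeight
  positivity

/-- The `i`-th term of the series. -/
noncomputable def uT (α : ℝ) (q b : ℕ → ℕ) (i : ℕ) : ℝ := (b i : ℝ) * rWeight q b i * α ^ i

lemma uT_nonneg (α : ℝ) (hα0 : 0 < α) (q b : ℕ → ℕ) (i : ℕ) : 0 ≤ uT α q b i := by
  unfold uT
  have := rW_nonneg q b i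
  positivity

lemma uT_congr (α : ℝ) (q b c : ℕ → ℕ) (i : ℕ) (hi : 1 ≤ i) (h : ∀ t, 1 ≤ t → t ≤ i → b t = c t) :
    uT α q b i = uT α q c i := by
  unfold uT
  rw [h i hi le_rfl, rW_congr q b c i (fun t h1 h2 => h t h1 h2.le)]

lemma q_partial (α : ℝ) (hα0 : 0 < α) (q : ℕ → ℕ)
    (hqd : ∑' j : ℕ, (q j : ℝ) * α ^ (j + 1) = 1) (m : ℕ) : ∑ k ∈ Finset.range m, (q k : ℝ) * α ^ (k + 1) ≤ 1 := by
  have hs : Summable fun j : ℕ => (q j : ℝ) * α ^ (j + 1) := by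
    by_contra h
    rw [tsum_eq_zero_of_not_summable h] at hqd
    norm_num at hqd
  rw [← hqd]
  exact hs.sum_le_tsum _ (fun i _ => by positivity)

lemma u_bound (α : ℝ) (hα0 : 0 < α) (q : ℕ → ℕ) (hq0 : q 0 = 1)
    (hqd : ∑' j : ℕ, (q j : ℝ) * α ^ (j + 1) = 1) (b : ℕ → ℕ) (hb : ∀ i, b i = 0 ∨ b i = 1) (M : ℕ) : ∀ j m : ℕ, (j = 0 ∨ b j = 0) →
    (∀ t, j < t → t < j + 1 + m → b t = 1) →
    ∑ t ∈ Finset.range M, uT α q b (j + 1 + m + t) ≤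
      rWeight q b j * α ^ j * (1 - ∑ k ∈ Finset.range m, (q k : ℝ) * α ^ (k + 1)) := by
  induction M with
  | zero =>
    intro j m _ _
    have h1 := q_partial α hα0 q hqd m
    have h2 := rW_nonneg q b j
    have : 0 ≤ 1 - ∑ k ∈ Finset.range m, (q k : ℝ) * α ^ (k + 1) := by linarith
    simp only [Finset.range_zero, Finset.sum_empty]
    positivity
  | succ M ih =>
    intro j m hj h1
    rw [Finset.sum_range_succ']
    have hr := rW_split q hq0 b j m hj h1
    rcases hb (j + 1 + m) with h | h
    · have := ih (j + 1 + m) 0 (Or.inr h) (fun t h1 h2 => by omega)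
      have e : ∑ t ∈ Finset.range M, uT α q b (j + 1 + m + (t + 1)) =
          ∑ t ∈ Finset.range M, uT α q b (j + 1 + m + 1 + 0 + t) :=
        Finset.sum_congr rfl (fun t _ => by congr 1; ring)
      rw [e]
      have e0 : uT α q b (j + 1 + m + 0) = 0 := by simp [uT, h]
      rw [e0]
      have hq := q_partial α hα0 q hqd (m + 1)
      rw [Finset.sum_range_succ] at hq
      have h2 := rW_nonneg q b j
      have h3 : 0 ≤ rWeight q b j * α ^ j := by positivity
      simp only [Finset.range_zero, Finset.sum_empty, sub_zero, mul_one] at this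
      rw [hr] at this
      have e4 : rWeight q b j * ↑(q m) * α ^ (j + 1 + m) =
        rWeight q b j * α ^ j * (q m * α ^ (m + 1)) := by ring
      rw [e4] at this
      have := mul_le_mul_of_nonneg_left (show (q m * α ^ (m + 1)) ≤
        1 - ∑ k ∈ Finset.range m, (q k : ℝ) * α ^ (k + 1) by linarith) h3
      linarith
    · have := ih j (m + 1) hj (fun t h2 h3 => by
        by_cases ht : t = j + 1 + m
        · rw [ht, h]
        · exact h1 t h2 (by omega))
      have e : ∑ t ∈ Finset.range M, uT α q b (j + 1 + m + (t + 1)) =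
          ∑ t ∈ Finset.range M, uT α q b (j + 1 + (m + 1) + t) :=
        Finset.sum_congr rfl (fun t _ => by congr 1; ring)
      rw [e]
      have e0 : uT α q b (j + 1 + m + 0) = rWeight q b j * α ^ j * (q m * α ^ (m + 1)) := by
        simp only [uT, add_zero, h, hr]; push_cast; ring
      rw [e0]
      rw [Finset.sum_range_succ] at this
      linarith

lemma u_summable (α : ℝ) (hα0 : 0 < α) (q : ℕ → ℕ) (hq0 : q 0 = 1)
    (hqd : ∑' j : ℕ, (q j : ℝ) * α ^ (j + 1) = 1) (b : ℕ → ℕ) (hb : ∀ i, b i = 0 ∨ b i = 1) :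
    Summable fun i => uT α q b (i + 1) := by
  apply summable_of_sum_range_le (c := 1) (fun i => uT_nonneg α hα0 q b _)
  intro M
  have := u_bound α hα0 q hq0 hqd b hb M 0 0 (Or.inl rfl) (fun t h1 h2 => by omega)
  have e : ∀ t, 0 + 1 + 0 + t = t + 1 := fun t => by ring
  simp only [e] at this
  refine this.trans ?_
  simp [rWeight]

lemma u_tail (α : ℝ) (hα0 : 0 < α) (q : ℕ → ℕ) (hq0 : q 0 = 1)
    (hqd : ∑' j : ℕ, (q j : ℝ) * α ^ (j + 1) = 1) (b : ℕ → ℕ) (hb : ∀ i, b i = 0 ∨ b i = 1) (n : ℕ) (hn : b (n + 1) = 0) :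
    ∑' i, uT α q b (i + 1) ≤
      ∑ i ∈ Finset.range n, uT α q b (i + 1) + rWeight q b (n + 1) * α ^ (n + 1) := by
  have hs := u_summable α hα0 q hq0 hqd b hb
  rw [← hs.sum_add_tsum_nat_add (n + 1), Finset.sum_range_succ]
  have e0 : uT α q b (n + 1) = 0 := by simp [uT, hn]
  rw [e0, add_zero]
  gcongr
  apply Real.tsum_le_of_sum_range_le (fun i => uT_nonneg α hα0 q b _)
  intro M
  have := u_bound α hα0 q hq0 hqd b hb M (n + 1) 0 (Or.inr hn) (fun t h1 h2 => by omega)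
  have e : ∑ t ∈ Finset.range M, uT α q b (n + 1 + 1 + 0 + t) =
      ∑ t ∈ Finset.range M, uT α q b (t + (n + 1) + 1) :=
    Finset.sum_congr rfl (fun t _ => by congr 1; ring)
  rw [e] at this
  simpa only [Finset.range_zero, Finset.sum_empty, sub_zero, mul_one] using this

lemma u_mono (α : ℝ) (hα0 : 0 < α) (q : ℕ → ℕ) (hq0 : q 0 = 1)
    (hqd : ∑' j : ℕ, (q j : ℝ) * α ^ (j + 1) = 1) (b c : ℕ → ℕ) (hb : ∀ i, b i = 0 ∨ b i = 1) (hc : ∀ i, c i = 0 ∨ c i = 1) (n : ℕ)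
    (hn : b (n + 1) = 0) (hn' : c (n + 1) = 1) (h : ∀ t, 1 ≤ t → t ≤ n → b t = c t) :
    ∑' i, uT α q b (i + 1) ≤ ∑' i, uT α q c (i + 1) := by
  refine (u_tail α hα0 q hq0 hqd b hb n hn).trans ?_
  have hs := u_summable α hα0 q hq0 hqd c hc
  refine le_trans (le_of_eq ?_) (hs.sum_le_tsum (Finset.range (n + 1))
    (fun i _ => uT_nonneg α hα0 q c _))
  rw [Finset.sum_range_succ]
  congr 1
  · apply Finset.sum_congr rfl
    intro i hi
    simp only [Finset.mem_range] at hi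
    exact uT_congr α q b c _ (by omega) (fun t h1 h2 => h t h1 (by omega))
  · rw [rW_congr q b c (n + 1) (fun t h1 h2 => h t h1 (by omega))]
    simp [uT, hn']

lemma binDigit_01 (x : ℝ) (i : ℕ) : binDigit x i = 0 ∨ binDigit x i = 1 := by
  unfold binDigit; omega

lemma binDigit_nat (x : ℝ) (hx : 0 ≤ x) (i : ℕ) : binDigit x i = ⌊x * 2 ^ i⌋₊ % 2 := by
  unfold binDigit
  rfl

lemma floor_half (x : ℝ) (i : ℕ) : ⌊x * 2 ^ i⌋₊ = ⌊x * 2 ^ (i + 1)⌋₊ / 2 := by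
  rw [← Nat.floor_div_natCast]
  congr 1
  push_cast
  ring

lemma fCA_eq (α : ℝ) (q : ℕ → ℕ) (x : ℝ) (hx : x ≠ 1) :
    fCA α q x = ∑' i, uT α q (binDigit x) (i + 1) := by
  unfold fCA uT
  rw [if_neg hx]

lemma fCA_mono (α : ℝ) (hα0 : 0 < α) (q : ℕ → ℕ) (hq0 : q 0 = 1)
    (hqd : ∑' j : ℕ, (q j : ℝ) * α ^ (j + 1) = 1) : MonotoneOn (fCA α q) (Set.Ioo 0 1) := by
  intro x hx y hy hxy
  rcases hxy.eq_or_lt with h | hlt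
  · rw [h]
  rw [fCA_eq α q x hx.2.ne, fCA_eq α q y hy.2.ne]
  have hex : ∃ n : ℕ, ⌊x * 2 ^ n⌋₊ ≠ ⌊y * 2 ^ n⌋₊ := by
    obtain ⟨n, hn⟩ := pow_unbounded_of_one_lt (1 / (y - x)) (one_lt_two : (1:ℝ) < 2)
    refine ⟨n, ?_⟩
    rw [div_lt_iff₀ (by linarith)] at hn
    intro he
    have h1 := Nat.floor_le (show 0 ≤ x * 2 ^ n from mul_nonneg hx.1.le (by positivity))
    have h2 := Nat.lt_floor_add_one (y * 2 ^ n)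
    rw [← he] at h2
    nlinarith
  classical
  have hsp := Nat.find_spec hex
  have hmin := fun m => Nat.find_min (m := m) hex
  set N := Nat.find hex with hN
  rcases Nat.eq_zero_or_pos N with h0 | hpos
  · exfalso
    apply hsp
    rw [h0]
    simp only [pow_zero, mul_one]
    rw [Nat.floor_eq_zero.2 hx.2, Nat.floor_eq_zero.2 hy.2]
  obtain ⟨n, hn⟩ : ∃ n, N = n + 1 := ⟨N - 1, by omega⟩
  rw [hn] at hsp hmin
  have hle : ⌊x * 2 ^ (n + 1)⌋₊ ≤ ⌊y * 2 ^ (n + 1)⌋₊ := Nat.floor_mono (by gcongr)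
  have he : ⌊x * 2 ^ n⌋₊ = ⌊y * 2 ^ n⌋₊ := not_not.1 (hmin n (by omega))
  rw [floor_half x n, floor_half y n] at he
  apply u_mono α hα0 q hq0 hqd _ _ (binDigit_01 x) (binDigit_01 y) n
  · rw [binDigit_nat x hx.1.le]; omega
  · rw [binDigit_nat y hy.1.le]; omega
  · intro t h1 h2
    rw [binDigit_nat x hx.1.le, binDigit_nat y hy.1.le, not_not.1 (hmin t (by omega))]

lemma dig_dyadic (k n i : ℕ) :
    binDigit ((k : ℝ) / 2 ^ n) i = if i ≤ n then k / 2 ^ (n - i) % 2 else 0 := by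
  rw [binDigit_nat _ (by positivity)]
  split_ifs with h
  · have : (k : ℝ) / 2 ^ n * 2 ^ i = (k : ℝ) / ((2 ^ (n - i) : ℕ) : ℝ) := by
      obtain ⟨d, rfl⟩ := Nat.exists_eq_add_of_le h
      simp only [Nat.add_sub_cancel_left]
      push_cast
      field_simp
      ring
    rw [this, Nat.floor_div_natCast, Nat.floor_natCast]
  · obtain ⟨d, rfl⟩ := Nat.exists_eq_add_of_lt (not_le.1 h)
    have : (k : ℝ) / 2 ^ n * 2 ^ (n + d + 1) = ((2 * (k * 2 ^ d) : ℕ) : ℝ) := by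
      push_cast
      field_simp
      ring
    rw [this, Nat.floor_natCast]
    omega

lemma f_dyadic (α : ℝ) (q : ℕ → ℕ) (k n : ℕ) (h1 : (k : ℝ) / 2 ^ n ≠ 1) :
    fCA α q (k / 2 ^ n) = ∑ i ∈ Finset.range n, uT α q (binDigit (k / 2 ^ n)) (i + 1) := by
  rw [fCA_eq _ _ _ h1]
  apply tsum_eq_sum
  intro i hi
  simp only [Finset.mem_range] at hi
  unfold uT
  rw [dig_dyadic, if_neg (by omega)]
  simp

lemma f_diff (α : ℝ) (q : ℕ → ℕ) (k n : ℕ) (hn : 1 ≤ n) (hk : 2 ∣ k) (hkn : k < 2 ^ n) :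
    fCA α q (((k + 1 : ℕ) : ℝ) / 2 ^ n) - fCA α q ((k : ℝ) / 2 ^ n) =
      rWeight q (binDigit (k / 2 ^ n)) n * α ^ n := by
  obtain ⟨n, rfl⟩ : ∃ m, n = m + 1 := ⟨n - 1, by omega⟩
  have hlt : k + 1 < 2 ^ (n + 1) := by rw [pow_succ] at *; omega
  have n1 : ((k + 1 : ℕ) : ℝ) / 2 ^ (n + 1) ≠ 1 := by
    apply ne_of_lt
    rw [div_lt_one (by positivity)]
    exact_mod_cast hlt
  have n2 : ((k : ℕ) : ℝ) / 2 ^ (n + 1) ≠ 1 := by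
    apply ne_of_lt
    rw [div_lt_one (by positivity)]
    exact_mod_cast hkn
  rw [f_dyadic _ _ _ _ n1, f_dyadic _ _ _ _ n2, Finset.sum_range_succ, Finset.sum_range_succ]
  have hd : ∀ t, 1 ≤ t → t ≤ n → binDigit (((k + 1 : ℕ) : ℝ) / 2 ^ (n + 1)) t =
      binDigit ((k : ℝ) / 2 ^ (n + 1)) t := by
    intro t ht1 ht2
    rw [dig_dyadic, dig_dyadic, if_pos (by omega), if_pos (by omega)]
    have : n + 1 - t = (n - t) + 1 := by omega
    rw [this, pow_succ', ← Nat.div_div_eq_div_mul, ← Nat.div_div_eq_div_mul]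
    have : (k + 1) / 2 = k / 2 := by omega
    rw [this]
  have e1 : ∑ i ∈ Finset.range n, uT α q (binDigit (((k + 1 : ℕ) : ℝ) / 2 ^ (n + 1))) (i + 1) =
      ∑ i ∈ Finset.range n, uT α q (binDigit ((k : ℝ) / 2 ^ (n + 1))) (i + 1) := by
    apply Finset.sum_congr rfl
    intro i hi
    simp only [Finset.mem_range] at hi
    exact uT_congr α q _ _ _ (by omega) (fun t h1 h2 => hd t h1 (by omega))
  have d1 : binDigit (((k + 1 : ℕ) : ℝ) / 2 ^ (n + 1)) (n + 1) = 1 := by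
    rw [dig_dyadic, if_pos le_rfl]
    simp only [Nat.sub_self, pow_zero, Nat.div_one]
    omega
  have d2 : binDigit ((k : ℝ) / 2 ^ (n + 1)) (n + 1) = 0 := by
    rw [dig_dyadic, if_pos le_rfl]
    simp only [Nat.sub_self, pow_zero, Nat.div_one]
    omega
  rw [e1]
  unfold uT
  rw [d1, d2, rW_congr q _ _ (n + 1) (fun t h1 h2 => hd t h1 (by omega))]
  push_cast
  ring

lemma f_ratio (α : ℝ) (q : ℕ → ℕ) (hq0 : q 0 = 1) (k n : ℕ) (hn : 1 ≤ n) (hk : 2 ∣ k)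
    (hkn : k < 2 ^ n) :
    fCA α q (((2 * k + 1 : ℕ) : ℝ) / 2 ^ (n + 1)) - fCA α q (((2 * k : ℕ) : ℝ) / 2 ^ (n + 1)) =
      α * (fCA α q (((k + 1 : ℕ) : ℝ) / 2 ^ n) - fCA α q ((k : ℝ) / 2 ^ n)) := by
  rw [f_diff α q k n hn hk hkn, f_diff α q (2 * k) (n + 1) (by omega) (by omega)
    (by rw [pow_succ]; omega)]
  have e : ((2 * k : ℕ) : ℝ) / 2 ^ (n + 1) = (k : ℝ) / 2 ^ n := by
    push_cast
    field_simp
    ring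
  rw [e]
  have d2 : binDigit ((k : ℝ) / 2 ^ n) n = 0 := by
    rw [dig_dyadic, if_pos le_rfl]
    simp only [Nat.sub_self, pow_zero, Nat.div_one]
    omega
  have := rW_split q hq0 _ n 0 (Or.inr d2) (fun t h1 h2 => by omega)
  rw [add_zero] at this
  rw [this, hq0]
  push_cast
  ring

lemma straddle (f : ℝ → ℝ) (x L : ℝ) (hx : 0 ≤ x) (h : HasDerivAt f L x) :
    Filter.Tendsto (fun n : ℕ => 2 ^ n * (f (((⌊x * 2 ^ n⌋₊ + 1 : ℕ) : ℝ) / 2 ^ n) -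
      f ((⌊x * 2 ^ n⌋₊ : ℝ) / 2 ^ n))) Filter.atTop (nhds L) := by
  have ho := h.isLittleO
  rw [Metric.tendsto_atTop]
  intro ε hε
  have h1 := ho.def (half_pos hε)
  obtain ⟨δ, hδ, hball⟩ := Metric.eventually_nhds_iff.1 h1
  obtain ⟨N, hN⟩ := pow_unbounded_of_one_lt (1 / δ) (one_lt_two : (1:ℝ) < 2)
  refine ⟨N, fun n hn => ?_⟩
  have hp : (0:ℝ) < 2 ^ n := by positivity
  have hn2 : 1 / δ < (2:ℝ) ^ n := hN.trans_le (pow_le_pow_right₀ one_le_two hn)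
  rw [div_lt_iff₀ hδ] at hn2
  have f1 := Nat.floor_le (show 0 ≤ x * 2 ^ n by positivity)
  have f2 := Nat.lt_floor_add_one (x * 2 ^ n)
  push_cast
  set k : ℝ := (⌊x * 2 ^ n⌋₊ : ℝ) with hk
  have i1 : k / 2 ^ n ≤ x := by rw [div_le_iff₀ hp]; exact f1
  have i2 : x < (k + 1) / 2 ^ n := by rw [lt_div_iff₀ hp]; exact f2
  have i3 : (k + 1) / 2 ^ n - k / 2 ^ n = 1 / 2 ^ n := by ring
  have i4 : 1 / 2 ^ n < δ := by rw [div_lt_iff₀ hp]; linarith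
  have g1 := hball (y := k / 2 ^ n) (by rw [Real.dist_eq, abs_lt]; constructor <;> linarith)
  have g2 := hball (y := (k + 1) / 2 ^ n) (by rw [Real.dist_eq, abs_lt]; constructor <;> linarith)
  simp only [Real.norm_eq_abs, smul_eq_mul] at g1 g2
  rw [abs_of_nonpos (by linarith : k / 2 ^ n - x ≤ 0), abs_le] at g1
  rw [abs_of_nonneg (by linarith : 0 ≤ (k + 1) / 2 ^ n - x), abs_le] at g2
  set A := f (k / 2 ^ n)
  set B := f ((k + 1) / 2 ^ n)
  have i5 : (k + 1) / 2 ^ n = k / 2 ^ n + 1 / 2 ^ n := by ring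
  rw [i5] at g2
  set a := k / 2 ^ n
  set w : ℝ := 1 / 2 ^ n with hw
  have hw1 : 2 ^ n * w = 1 := by rw [hw]; field_simp
  have j1 : B - A - w * L ≤ ε / 2 * w := by nlinarith [g1.1, g2.2]
  have j2 : -(ε / 2 * w) ≤ B - A - w * L := by nlinarith [g1.2, g2.1]
  have k1 := mul_le_mul_of_nonneg_left j1 hp.le
  have k2 := mul_le_mul_of_nonneg_left j2 hp.le
  have l1 : 2 ^ n * (B - A - w * L) = 2 ^ n * (B - A) - L := by linear_combination -L * hw1
  have l2 : 2 ^ n * (ε / 2 * w) = ε / 2 := by linear_combination ε / 2 * hw1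
  rw [l1, l2] at k1
  have l3 : 2 ^ n * (-(ε / 2 * w)) = -(ε / 2) := by linear_combination -ε / 2 * hw1
  rw [l1, l3] at k2
  rw [Real.dist_eq, abs_lt]
  constructor <;> linarith

/-- Points of the unit interval with no zero base-4 digit. -/
def badE : Set ℝ := {x | 0 ≤ x ∧ x < 1 ∧ ∀ j : ℕ, ⌊x * 4 ^ (j + 1)⌋ % 4 ≠ 0}

lemma vol_pre (c : ℝ) (hc : 0 < c) (d : ℝ) (S : Set ℝ) :
    volume ((fun x => c * x - d) ⁻¹' S) = ENNReal.ofReal c⁻¹ * volume S := by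
  have : (fun x => c * x - d) ⁻¹' S = (c * ·) ⁻¹' ((fun x => x + (-d)) ⁻¹' S) := by
    ext x; simp [sub_eq_add_neg]
  rw [this, Real.volume_preimage_mul_left hc.ne', measure_preimage_add_right, abs_of_pos (by positivity)]

lemma badE_null : volume badE = 0 := by
  have hsub : badE ⊆ ((fun x => 4 * x - 1) ⁻¹' badE ∪ (fun x => 4 * x - 2) ⁻¹' badE) ∪
      (fun x => 4 * x - 3) ⁻¹' badE := by
    intro x hx
    obtain ⟨h0, h1, h⟩ := hx
    have key : ∀ d : ℤ, ⌊4 * x⌋ = d → 4 * x - d ∈ badE := by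
      intro d hd
      rw [Int.floor_eq_iff] at hd
      refine ⟨by linarith, by linarith, fun j => ?_⟩
      have e : (4 * x - d) * 4 ^ (j + 1) = x * 4 ^ (j + 1 + 1) - ((4 * (d * 4 ^ j) : ℤ) : ℝ) := by
        push_cast; ring
      rw [e, Int.floor_sub_intCast]
      have := h (j + 1)
      omega
    have hh := h 0
    have e : x * 4 ^ (0 + 1) = 4 * x := by ring
    rw [e] at hh
    have b1 : 0 ≤ ⌊4 * x⌋ := Int.floor_nonneg.2 (by linarith)
    have b2 : ⌊4 * x⌋ < 4 := Int.floor_lt.2 (by push_cast; linarith)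
    have : ⌊4 * x⌋ = 1 ∨ ⌊4 * x⌋ = 2 ∨ ⌊4 * x⌋ = 3 := by omega
    rcases this with h | h | h
    · left; left; simpa using key _ h
    · left; right; simpa using key _ h
    · right; simpa using key _ h
  have hle : volume badE ≤ 3 * (ENNReal.ofReal 4⁻¹ * volume badE) := by
    refine (measure_mono hsub).trans ((measure_union_le _ _).trans
      ((add_le_add_left (measure_union_le _ _) _).trans (le_of_eq ?_)))
    rw [vol_pre 4 (by norm_num), vol_pre 4 (by norm_num), vol_pre 4 (by norm_num)]
    ring
  have hfin : volume badE ≠ ⊤ := by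
    apply ne_top_of_le_ne_top _ (measure_mono (show badE ⊆ Set.Icc 0 1 from
      fun x hx => ⟨hx.1, hx.2.1.le⟩))
    simp
  have hr := ENNReal.toReal_mono (by finiteness) hle
  rw [ENNReal.toReal_mul, ENNReal.toReal_mul, ENNReal.toReal_ofReal (by norm_num)] at hr
  have h3 : (3 : ENNReal).toReal = 3 := by simp
  rw [h3] at hr
  have h0 : 0 ≤ (volume badE).toReal := ENNReal.toReal_nonneg
  have : (volume badE).toReal = 0 := by linarith
  exact ((ENNReal.toReal_eq_zero_iff _).1 this).resolve_right hfin

lemma ae_freq : ∀ᵐ x : ℝ, 0 ≤ x → ∃ᶠ n : ℕ in Filter.atTop, ⌊x * 2 ^ (n + 1)⌋₊ % 4 = 0 := by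
  have hnull : ∀ᵐ x : ℝ, ∀ N k : ℕ, (2:ℝ) ^ N * x - k ∉ badE := by
    rw [ae_all_iff]; intro N
    rw [ae_all_iff]; intro k
    rw [ae_iff]
    simp only [not_not]
    have := vol_pre (2 ^ N) (by positivity) k badE
    rw [badE_null, mul_zero] at this
    exact this
  filter_upwards [hnull] with x hx h0
  rw [Filter.frequently_atTop]
  intro N
  by_contra hc
  push Not at hc
  apply hx N ⌊x * 2 ^ N⌋₊
  have f1 := Nat.floor_le (show 0 ≤ x * 2 ^ N by positivity)
  have f2 := Nat.lt_floor_add_one (x * 2 ^ N)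
  refine ⟨by linarith, by linarith, fun j => ?_⟩
  set k := ⌊x * 2 ^ N⌋₊
  have e : ((2:ℝ) ^ N * x - k) * 4 ^ (j + 1) =
      x * 2 ^ (N + 2 * j + 1 + 1) - ((4 * (k * 4 ^ j) : ℤ) : ℝ) := by
    have : (4:ℝ) ^ j = 2 ^ (2 * j) := by rw [pow_mul]; norm_num
    push_cast
    rw [pow_succ 4 j, this]; ring
  rw [e, Int.floor_sub_intCast]
  have := hc (N + 2 * j + 1) (by omega)
  rw [← Int.natCast_floor_eq_floor (show 0 ≤ x * 2 ^ (N + 2 * j + 1 + 1) by positivity)]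
  omega

/-- Part (iii) of the singularity criterion: f has derivative zero a.e. on [0,1]. -/
theorem fCA_deriv_zero_ae (α : ℝ) (hα0 : 0 < α) (hα : α < 1/2)
    (q : ℕ → ℕ) (hq0 : q 0 = 1) (hqpos : ∀ s, 0 < q s)
    (hqb : ∀ s₁ s₂ : ℕ, 0 < s₁ → 0 < s₂ →
      q s₁ * q (s₂ - 1) < q (s₁ + s₂) ∧ q (s₁ + s₂) ≤ q s₁ * q s₂)
    (hqc : ∀ s : ℕ, 0 < s →
      (q (s + 1) : ℝ) * α ^ (s + 2) < (q s : ℝ) * α ^ (s + 1) ∧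
      (q s : ℝ) * α ^ (s + 1) < ∑' j : ℕ, (q (s + 1 + j) : ℝ) * α ^ (s + 2 + j))
    (hqd : ∑' j : ℕ, (q j : ℝ) * α ^ (j + 1) = 1)
    : ∀ᵐ x ∂(volume.restrict (Set.Icc (0:ℝ) 1)), HasDerivAt (fCA α q) 0 x := by
  have hm := fCA_mono α hα0 q hq0 hqd
  have hd := hm.ae_differentiableWithinAt_of_mem
  rw [ae_restrict_iff' measurableSet_Icc]
  have n0 : ∀ᵐ x : ℝ, x ≠ 0 := by simp [ae_iff]
  have n1 : ∀ᵐ x : ℝ, x ≠ 1 := by simp [ae_iff]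
  filter_upwards [hd, n0, n1, ae_freq] with x hx hx0 hx1 hfr hmem
  have hI : x ∈ Set.Ioo (0:ℝ) 1 :=
    ⟨lt_of_le_of_ne hmem.1 (Ne.symm hx0), lt_of_le_of_ne hmem.2 hx1⟩
  have hdiff := ((hx hI).differentiableAt (isOpen_Ioo.mem_nhds hI)).hasDerivAt
  set L := deriv (fCA α q) x
  suffices hL : L = 0 by rwa [hL] at hdiff
  have ht := straddle _ x L hmem.1 hdiff
  set D : ℕ → ℝ := fun n : ℕ => 2 ^ n * (fCA α q (((⌊x * 2 ^ n⌋₊ + 1 : ℕ) : ℝ) / 2 ^ n) -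
      fCA α q ((⌊x * 2 ^ n⌋₊ : ℝ) / 2 ^ n)) with hD
  have ht1 : Filter.Tendsto (fun n => D (n + 1) - 2 * α * D n) Filter.atTop
      (nhds (L - 2 * α * L)) :=
    ((Filter.tendsto_add_atTop_iff_nat 1).2 ht).sub (ht.const_mul _)
  have hf : ∃ᶠ n in Filter.atTop, D (n + 1) - 2 * α * D n ∈ ({0} : Set ℝ) := by
    refine ((hfr hmem.1).and_eventually (Filter.eventually_ge_atTop 1)).mono ?_
    rintro n ⟨hn4, hn1⟩
    have hh := floor_half x n
    have hK : ⌊x * 2 ^ (n + 1)⌋₊ = 2 * ⌊x * 2 ^ n⌋₊ := by omega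
    have hlt : ⌊x * 2 ^ n⌋₊ < 2 ^ n := by
      rw [Nat.floor_lt (mul_nonneg hmem.1 (by positivity))]
      push_cast
      have : (0:ℝ) < 2 ^ n := by positivity
      nlinarith [hI.2]
    have := f_ratio α q hq0 ⌊x * 2 ^ n⌋₊ n hn1 (by omega) hlt
    simp only [hD, Set.mem_singleton_iff]
    rw [hK, this]
    ring
  have h0 := isClosed_singleton.mem_of_frequently_of_tendsto hf ht1
  simp only [Set.mem_singleton_iff] at h0
  have : L * (1 - 2 * α) = 0 := by linarith
  rcases mul_eq_zero.1 this with h | h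
  · exact h
  · linarith
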